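/- Let n ≥ 2 and let V, D be radial functions in C(ℝⁿ) ∩ C^δ(B_δ) for some δ > 0, with V ≥ 0, D ≥ −λ₀ − V/λ₀ for some λ₀ > 0, and suppose that for some d_∞ ∈ ℝ and R > 1 one has V(r) ∈ L¹([R,∞)) and D(r) = d_∞/r + D_∞(r) with D_∞ ∈ L¹([R,∞)). Then there exists a C² solution φ_{λ₀} of Δφ_{λ₀} = (λ₀² + λ₀D + V)φ_{λ₀} on ℝⁿ satisfying, for some constants 0 < c < C, c⟨r⟩^{−(n−1−d_∞)/2} e^{λ₀r} ≤ φ_{λ₀}(x) ≤ C⟨r⟩^{−(n−1−d_∞)/2} e^{λ₀r} for all x, where r = |x| and ⟨r⟩ = √(1+r²). -/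

import Mathlib

open MeasureTheory Set Real Filter
open scoped NNReal ENNReal

noncomputable section

abbrev Eucl (n : ℕ) := EuclideanSpace ℝ (Fin n)

/-- The Laplacian of `f : ℝⁿ → ℝ`, as the sum of the second partial derivatives. -/
noncomputable def lap {n : ℕ} (f : Eucl n → ℝ) (x : Eucl n) : ℝ :=
  ∑ i : Fin n, fderiv ℝ (fun y => fderiv ℝ f y (EuclideanSpace.single i 1)) x
    (EuclideanSpace.single i 1)

/-- The weighted average `∫₀¹ t^(n-1) q(rt) f(rt) dt`. -/
def radialAverage (n : ℕ) (q f : ℝ → ℝ) (r : ℝ) : ℝ :=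
  ∫ t in (0 : ℝ)..1, t ^ (n - 1) * (q (r * t) * f (r * t))

/-- The Volterra operator inverting the radial Laplacian, evaluated at `|r|`. -/
def radialVolterra (n : ℕ) (q f : ℝ → ℝ) (r : ℝ) : ℝ :=
  ∫ s in (0 : ℝ)..|r|, s * radialAverage n q f s

lemma continuous_radialAverage (n : ℕ) {q f : ℝ → ℝ} (hq : Continuous q) (hf : Continuous f) :
    Continuous (radialAverage n q f) := by
  unfold radialAverage
  apply intervalIntegral.continuous_parametric_intervalIntegral_of_continuous'
  fun_prop

lemma continuous_radialVolterra (n : ℕ) {q f : ℝ → ℝ} (hq : Continuous q) (hf : Continuous f) :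
    Continuous (radialVolterra n q f) := by
  have h := continuous_radialAverage n hq hf
  unfold radialVolterra
  exact (intervalIntegral.continuous_primitive
    (fun a b => (continuous_id.mul h).intervalIntegrable a b) 0).comp continuous_abs

lemma radialAverage_nonneg (n : ℕ) {q f : ℝ → ℝ} (hq : ∀ r, 0 ≤ q r) (hf : ∀ r, 0 ≤ f r)
    (r : ℝ) : 0 ≤ radialAverage n q f r :=
  intervalIntegral.integral_nonneg zero_le_one fun _ ht =>
    mul_nonneg (pow_nonneg ht.1 _) (mul_nonneg (hq _) (hf _))

lemma radialVolterra_nonneg (n : ℕ) {q f : ℝ → ℝ} (hq : ∀ r, 0 ≤ q r) (hf : ∀ r, 0 ≤ f r)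
    (r : ℝ) : 0 ≤ radialVolterra n q f r :=
  intervalIntegral.integral_nonneg (abs_nonneg r) fun s hs =>
    mul_nonneg hs.1 (radialAverage_nonneg n hq hf s)

lemma radialVolterra_sub (n : ℕ) {q f₁ f₂ : ℝ → ℝ} (hq : Continuous q) (h₁ : Continuous f₁)
    (h₂ : Continuous f₂) (r : ℝ) :
    radialVolterra n q f₁ r - radialVolterra n q f₂ r =
      radialVolterra n q (fun s => f₁ s - f₂ s) r := by
  have hc₁ := continuous_radialAverage n hq h₁
  have hc₂ := continuous_radialAverage n hq h₂
  have havg : ∀ s, radialAverage n q f₁ s - radialAverage n q f₂ s =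
      radialAverage n q (fun s => f₁ s - f₂ s) s := by
    intro s
    unfold radialAverage
    rw [← intervalIntegral.integral_sub]
    · congr 1; ext t; ring
    · exact Continuous.intervalIntegrable (by fun_prop) _ _
    · exact Continuous.intervalIntegrable (by fun_prop) _ _
  unfold radialVolterra
  rw [← intervalIntegral.integral_sub]
  · congr 1; ext s; rw [← havg]; ring
  · exact Continuous.intervalIntegrable (by fun_prop) _ _
  · exact Continuous.intervalIntegrable (by fun_prop) _ _

/-- The weight `exp (2 ∫₀^|r| ∫₀^s q)`, for which the radial Volterra operator is a contraction. -/
def volterraWeight (q : ℝ → ℝ) (r : ℝ) : ℝ :=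
  Real.exp (2 * ∫ s in (0 : ℝ)..|r|, ∫ t in (0 : ℝ)..s, q t)

lemma continuous_primitive_of_continuous {q : ℝ → ℝ} (hq : Continuous q) :
    Continuous fun s => ∫ t in (0 : ℝ)..s, q t :=
  intervalIntegral.continuous_primitive (fun a b => hq.intervalIntegrable a b) 0

lemma continuous_volterraWeight {q : ℝ → ℝ} (hq : Continuous q) :
    Continuous (volterraWeight q) := by
  have h := (continuous_primitive_of_continuous
    (continuous_primitive_of_continuous hq)).comp continuous_abs
  exact Real.continuous_exp.comp (continuous_const.mul h)

lemma volterraWeight_mono {q : ℝ → ℝ} (hq : Continuous q) (hq0 : ∀ r, 0 ≤ q r) {a b : ℝ}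
    (ha : 0 ≤ a) (hab : a ≤ b) : volterraWeight q a ≤ volterraWeight q b := by
  unfold volterraWeight
  rw [abs_of_nonneg ha, abs_of_nonneg (ha.trans hab)]
  gcongr
  apply intervalIntegral.integral_mono_interval le_rfl ha hab
  · refine (ae_restrict_iff' measurableSet_Ioc).2 (Eventually.of_forall fun s hs => ?_)
    exact intervalIntegral.integral_nonneg hs.1.le fun t _ => hq0 t
  · exact (continuous_primitive_of_continuous hq).intervalIntegrable _ _

lemma one_le_volterraWeight {q : ℝ → ℝ} (hq0 : ∀ r, 0 ≤ q r) (r : ℝ) :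
    1 ≤ volterraWeight q r :=
  Real.one_le_exp (mul_nonneg zero_le_two
    (intervalIntegral.integral_nonneg (abs_nonneg r) fun _ hs =>
      intervalIntegral.integral_nonneg hs.1 fun t _ => hq0 t))

lemma abs_radialAverage_le (n : ℕ) {q f : ℝ → ℝ} (hq : Continuous q) (hq0 : ∀ r, 0 ≤ q r)
    {c : ℝ} (hc : 0 ≤ c) (hfc : ∀ r, |f r| ≤ c * volterraWeight q r)
    {s : ℝ} (hs : 0 ≤ s) :
    |s * radialAverage n q f s| ≤ c * volterraWeight q s * ∫ t in (0 : ℝ)..s, q t := by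
  have h1 : |radialAverage n q f s| ≤ ∫ t in (0 : ℝ)..1, q (s * t) * (c * volterraWeight q s) := by
    unfold radialAverage
    rw [← Real.norm_eq_abs]
    refine intervalIntegral.norm_integral_le_of_norm_le zero_le_one
      (Eventually.of_forall fun t ht => ?_) (Continuous.intervalIntegrable (by fun_prop) _ _)
    rw [Real.norm_eq_abs, abs_mul, abs_mul, abs_of_nonneg (hq0 _),
      abs_of_nonneg (pow_nonneg ht.1.le _)]
    have hw := volterraWeight_mono hq hq0 (mul_nonneg hs ht.1.le) (mul_le_of_le_one_right hs ht.2)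
    have hp : t ^ (n - 1) ≤ 1 := pow_le_one₀ ht.1.le ht.2
    calc t ^ (n - 1) * (q (s * t) * |f (s * t)|) ≤ 1 * (q (s * t) * |f (s * t)|) := by
          gcongr
          exact mul_nonneg (hq0 _) (abs_nonneg _)
      _ ≤ _ := by
          rw [one_mul]
          gcongr
          · exact hq0 _
          · exact (hfc _).trans (by gcongr)
  have h2 : s * ∫ t in (0 : ℝ)..1, q (s * t) = ∫ t in (0 : ℝ)..s, q t := by simp
  rw [intervalIntegral.integral_mul_const] at h1
  rw [abs_mul, abs_of_nonneg hs, ← h2]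
  exact (mul_le_mul_of_nonneg_left h1 hs).trans_eq (by ring)

lemma abs_radialVolterra_le (n : ℕ) {q f : ℝ → ℝ} (hq : Continuous q) (hq0 : ∀ r, 0 ≤ q r)
    {c : ℝ} (hc : 0 ≤ c) (hfc : ∀ r, |f r| ≤ c * volterraWeight q r)
    (r : ℝ) : |radialVolterra n q f r| ≤ c / 2 * volterraWeight q r := by
  have hP := continuous_primitive_of_continuous hq
  have hw := continuous_volterraWeight hq
  let w : ℝ → ℝ := fun s => Real.exp (2 * ∫ u in (0 : ℝ)..s, ∫ t in (0 : ℝ)..u, q t)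
  have hwd : ∀ s, HasDerivAt w (w s * (2 * ∫ t in (0 : ℝ)..s, q t)) s := fun s =>
    ((hP.integral_hasStrictDerivAt 0 s).hasDerivAt.const_mul 2).exp
  have hint : ∫ s in (0 : ℝ)..|r|, w s * (2 * ∫ t in (0 : ℝ)..s, q t) = w |r| - w 0 := by
    have hwc : Continuous w := continuous_iff_continuousAt.2 fun s => (hwd s).continuousAt
    exact intervalIntegral.integral_eq_sub_of_hasDerivAt (fun s _ => hwd s)
      (Continuous.intervalIntegrable (by fun_prop) _ _)
  have hw0 : w 0 = 1 := by simp [w]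
  have h1 : |radialVolterra n q f r| ≤
      ∫ s in (0 : ℝ)..|r|, c / 2 * (w s * (2 * ∫ t in (0 : ℝ)..s, q t)) := by
    have hwc : Continuous w := continuous_iff_continuousAt.2 fun s => (hwd s).continuousAt
    unfold radialVolterra
    rw [← Real.norm_eq_abs]
    refine intervalIntegral.norm_integral_le_of_norm_le (abs_nonneg r)
      (Eventually.of_forall fun s hs => ?_) (Continuous.intervalIntegrable (by fun_prop) _ _)
    refine (abs_radialAverage_le n hq hq0 hc hfc hs.1.le).trans_eq ?_
    simp only [volterraWeight, w, abs_of_pos hs.1]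
    ring
  rw [intervalIntegral.integral_const_mul, hint, hw0] at h1
  refine h1.trans ?_
  change c / 2 * (volterraWeight q r - 1) ≤ _
  gcongr
  linarith

lemma exists_radialVolterra_fixedPoint (n : ℕ) {q : ℝ → ℝ} (hq : Continuous q)
    (hq0 : ∀ r, 0 ≤ q r) :
    ∃ f : ℝ → ℝ, Continuous f ∧ (∀ r, 1 ≤ f r) ∧ ∀ r, f r = 1 + radialVolterra n q f r := by
  have hw := continuous_volterraWeight hq
  have hw1 := one_le_volterraWeight hq0
  have hwpos : ∀ r, 0 < volterraWeight q r := fun r => one_pos.trans_le (hw1 r)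
  have hb : ∀ v : BoundedContinuousFunction ℝ ℝ, ∀ r,
      |volterraWeight q r * v r| ≤ ‖v‖ * volterraWeight q r := fun v r => by
    rw [abs_mul, abs_of_pos (hwpos r), mul_comm]
    gcongr
    · exact (hwpos r).le
    · exact v.norm_coe_le_norm r
  have hc : ∀ v : BoundedContinuousFunction ℝ ℝ,
      Continuous fun r => volterraWeight q r * v r := fun v => hw.mul v.continuous
  let T : BoundedContinuousFunction ℝ ℝ → BoundedContinuousFunction ℝ ℝ := fun v =>
    BoundedContinuousFunction.ofNormedAddCommGroup
      (fun r => (1 + radialVolterra n q (fun s => volterraWeight q s * v s) r) /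
        volterraWeight q r)
      ((continuous_const.add (continuous_radialVolterra n hq (hc v))).div hw
        fun r => (hwpos r).ne') (1 + ‖v‖ / 2) (fun r => by
        rw [Real.norm_eq_abs, abs_div, abs_of_pos (hwpos r), div_le_iff₀ (hwpos r)]
        have h1 := abs_radialVolterra_le n hq hq0 (norm_nonneg v) (hb v) r
        have h2 := abs_add_le 1 (radialVolterra n q (fun s => volterraWeight q s * v s) r)
        rw [abs_one] at h2
        linarith [hw1 r])
  have hT : ContractingWith (1 / 2) T := by
    refine ⟨by rw [← NNReal.coe_lt_coe]; norm_num, LipschitzWith.of_dist_le_mul fun v₁ v₂ => ?_⟩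
    rw [BoundedContinuousFunction.dist_le (by positivity)]
    intro r
    have h1 := abs_radialVolterra_le n hq hq0 (norm_nonneg (v₁ - v₂))
      (hb (v₁ - v₂)) r
    have h2 := radialVolterra_sub n hq (hc v₁) (hc v₂) r
    have h3 : (fun s => volterraWeight q s * v₁ s - volterraWeight q s * v₂ s) =
        fun s => volterraWeight q s * (v₁ - v₂) s := by
      ext s; simp [mul_sub]
    rw [h3] at h2
    rw [← h2] at h1
    simp only [T, BoundedContinuousFunction.coe_ofNormedAddCommGroup, Real.dist_eq]
    rw [← sub_div, abs_div, abs_of_pos (hwpos r), div_le_iff₀ (hwpos r), add_sub_add_left_eq_sub,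
      dist_eq_norm]
    refine h1.trans_eq ?_
    push_cast
    ring
  let v := ContractingWith.fixedPoint T hT
  have hv : T v = v := hT.fixedPoint_isFixedPt
  have hv0 : ∀ r, 0 ≤ v r := by
    intro r
    have hlim := hT.tendsto_iterate_fixedPoint 0
    have hlim' : Tendsto (fun k => (T^[k] 0) r) atTop (nhds (v r)) :=
      ((continuous_eval_const (F := BoundedContinuousFunction ℝ ℝ) r).tendsto v).comp hlim
    refine ge_of_tendsto' hlim' fun k => ?_
    have : ∀ k : ℕ, ∀ r, 0 ≤ (T^[k] 0) r := by
      intro k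
      induction k with
      | zero => intro r; simp
      | succ k ih =>
        intro r
        rw [Function.iterate_succ_apply']
        exact div_nonneg (add_nonneg zero_le_one (radialVolterra_nonneg n hq0
          (fun s => mul_nonneg (hwpos s).le (ih s)) r)) (hwpos r).le
    exact this k r
  have hfix : ∀ r, volterraWeight q r * v r =
      1 + radialVolterra n q (fun s => volterraWeight q s * v s) r := by
    intro r
    have h := congrArg (fun u : BoundedContinuousFunction ℝ ℝ => u r) hv
    simp only [T, BoundedContinuousFunction.coe_ofNormedAddCommGroup] at h
    rw [div_eq_iff (hwpos r).ne'] at h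
    rw [h, mul_comm]
  refine ⟨fun r => volterraWeight q r * v r, hc v, fun r => ?_, hfix⟩
  change 1 ≤ volterraWeight q r * v r
  rw [hfix]
  exact le_add_of_nonneg_right
    (radialVolterra_nonneg n hq0 (fun s => mul_nonneg (hwpos s).le (hv0 s)) r)

lemma pow_mul_radialAverage {n : ℕ} (hn : 1 ≤ n) (q f : ℝ → ℝ) (r : ℝ) :
    r ^ n * radialAverage n q f r = ∫ s in (0 : ℝ)..r, s ^ (n - 1) * (q s * f s) := by
  obtain ⟨k, rfl⟩ := Nat.exists_eq_add_of_le' hn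
  have h := intervalIntegral.mul_integral_comp_mul_left
    (f := fun s => s ^ (k + 1 - 1) * (q s * f s)) (a := 0) (b := 1) r
  rw [mul_zero, mul_one] at h
  rw [← h, pow_succ', mul_assoc]
  congr 1
  unfold radialAverage
  rw [← intervalIntegral.integral_const_mul]
  congr 1
  ext t
  simp only [Nat.add_sub_cancel]
  ring

lemma hasDerivAt_radialAverage {n : ℕ} (hn : 1 ≤ n) {q f : ℝ → ℝ} (hq : Continuous q)
    (hf : Continuous f) {r : ℝ} (hr : 0 < r) :
    HasDerivAt (radialAverage n q f) ((q r * f r - n * radialAverage n q f r) / r) r := by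
  have hM : HasDerivAt (fun r => ∫ s in (0 : ℝ)..r, s ^ (n - 1) * (q s * f s))
      (r ^ (n - 1) * (q r * f r)) r :=
    (Continuous.integral_hasStrictDerivAt (by fun_prop) 0 r).hasDerivAt
  have h := hM.div (hasDerivAt_pow n r) (pow_ne_zero n hr.ne')
  have heq : radialAverage n q f =ᶠ[nhds r]
      ((fun r => ∫ s in (0 : ℝ)..r, s ^ (n - 1) * (q s * f s)) / fun r => r ^ n) := by
    filter_upwards [lt_mem_nhds hr] with s hs
    rw [Pi.div_apply, ← pow_mul_radialAverage hn, mul_div_cancel_left₀ _ (pow_ne_zero n hs.ne')]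
  refine (h.congr_of_eventuallyEq heq).congr_deriv ?_
  rw [← pow_mul_radialAverage hn]
  obtain ⟨k, rfl⟩ := Nat.exists_eq_add_of_le' hn
  simp only [Nat.add_sub_cancel]
  field_simp
  ring

lemma mul_radialAverage_zero {n : ℕ} (hn : 1 ≤ n) (q f : ℝ → ℝ) :
    n * radialAverage n q f 0 = q 0 * f 0 := by
  obtain ⟨k, rfl⟩ := Nat.exists_eq_add_of_le' hn
  have hk : (k : ℝ) + 1 ≠ 0 := by positivity
  simp only [radialAverage, zero_mul, intervalIntegral.integral_mul_const, integral_pow,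
    Nat.add_sub_cancel]
  push_cast
  field_simp
  simp

lemma hasDerivAt_of_radialVolterra_fixedPoint {n : ℕ} {q f : ℝ → ℝ} (hq : Continuous q)
    (hf : Continuous f) (hfix : ∀ r, f r = 1 + radialVolterra n q f r) {r : ℝ} (hr : 0 < r) :
    HasDerivAt f (r * radialAverage n q f r) r := by
  have hc : Continuous fun s => s * radialAverage n q f s :=
    continuous_id.mul (continuous_radialAverage n hq hf)
  refine ((hc.integral_hasStrictDerivAt 0 r).hasDerivAt.const_add 1).congr_of_eventuallyEq ?_
  filter_upwards [lt_mem_nhds hr] with s hs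
  rw [hfix, radialVolterra, abs_of_pos hs]

section Radial

variable {E : Type*} [NormedAddCommGroup E] [InnerProductSpace ℝ E]

lemma hasFDerivAt_norm_of_ne_zero {x : E} (hx : x ≠ 0) :
    HasFDerivAt (fun y : E => ‖y‖) (‖x‖⁻¹ • innerSL ℝ x) x := by
  have h1 : HasFDerivAt (fun y : E => ‖y‖ ^ 2) (2 • innerSL ℝ x) x :=
    (hasStrictFDerivAt_norm_sq x).hasFDerivAt
  have hx' : ‖x‖ ≠ 0 := norm_ne_zero_iff.2 hx
  have h2 := h1.sqrt (pow_ne_zero 2 hx')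
  simp only [Real.sqrt_sq (norm_nonneg _)] at h2
  convert h2 using 1
  ext y
  simp
  field_simp

/-- A radial function `φ(|x|)` with `φ(r) = φ(0) + ∫₀^r s g(s) ds` has gradient `g(|x|) x`. -/
lemma hasFDerivAt_radial {φ g : ℝ → ℝ} (hg : Continuous g)
    (hφ : ∀ r, 0 ≤ r → φ r = φ 0 + ∫ s in (0 : ℝ)..r, s * g s) (x : E) :
    HasFDerivAt (fun y : E => φ ‖y‖) (g ‖x‖ • innerSL ℝ x) x := by
  let h : ℝ → ℝ := fun ρ => φ 0 + 1 / 2 * ∫ σ in (0 : ℝ)..ρ, g (√σ)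
  have hc : Continuous fun σ => g (√σ) := hg.comp Real.continuous_sqrt
  have hh : ∀ ρ, HasDerivAt h (1 / 2 * g (√ρ)) ρ := fun ρ =>
    ((hc.integral_hasStrictDerivAt 0 ρ).hasDerivAt.const_mul (1 / 2)).const_add _
  have heq : ∀ r, 0 ≤ r → φ r = h (r ^ 2) := by
    intro r hr
    have hd : ∀ s ∈ uIcc 0 r, HasDerivAt (fun s => h (s ^ 2)) (s * g s) s := by
      intro s hs
      rw [uIcc_of_le hr] at hs
      have := (hh (s ^ 2)).comp s (hasDerivAt_pow 2 s)
      rw [Real.sqrt_sq hs.1] at this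
      refine this.congr_deriv ?_
      push_cast
      ring
    rw [hφ r hr, intervalIntegral.integral_eq_sub_of_hasDerivAt hd
      (Continuous.intervalIntegrable (by fun_prop) _ _)]
    simp [h]
  have h1 : HasFDerivAt (fun y : E => h (‖y‖ ^ 2)) ((1 / 2 * g (√(‖x‖ ^ 2))) • (2 • innerSL ℝ x)) x :=
    (hh (‖x‖ ^ 2)).comp_hasFDerivAt (h₂ := h) (f := fun y : E => ‖y‖ ^ 2) x
      (hasStrictFDerivAt_norm_sq x).hasFDerivAt
  rw [Real.sqrt_sq (norm_nonneg _)] at h1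
  have h2 : (fun y : E => φ ‖y‖) = fun y : E => h (‖y‖ ^ 2) :=
    funext fun y => heq _ (norm_nonneg y)
  rw [h2]
  convert h1 using 1
  ext y
  simp
  ring

/-- The derivative of `x ↦ g(|x|) ⟪x, v⟫` when `g'(r) = m(r) / r`. -/
def radialHessian (g m : ℝ → ℝ) (v x : E) : E →L[ℝ] ℝ :=
  g ‖x‖ • innerSL ℝ v + (m ‖x‖ / ‖x‖ ^ 2 * inner ℝ x v) • innerSL ℝ x

lemma hasFDerivAt_radialGradient {g m : ℝ → ℝ} (hg : Continuous g)
    (hgd : ∀ r, 0 < r → HasDerivAt g (m r / r) r) (v x : E) :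
    HasFDerivAt (fun y : E => g ‖y‖ * inner ℝ y v) (radialHessian g m v x) x := by
  have hinner : ∀ y : E, HasFDerivAt (fun y : E => inner ℝ y v) (innerSL ℝ v) y := fun y => by
    simp only [real_inner_comm v]
    exact (innerSL ℝ v).hasFDerivAt
  rcases eq_or_ne x 0 with rfl | hx
  · rw [hasFDerivAt_iff_isLittleO_nhds_zero]
    simp only [radialHessian, zero_add, norm_zero, inner_zero_left, mul_zero, zero_smul,
      add_zero, sub_zero]
    have h0 : (fun y : E => g ‖y‖ - g 0) =o[nhds 0] (fun _ => (1 : ℝ)) := by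
      rw [Asymptotics.isLittleO_one_iff]
      have : Continuous fun y : E => g ‖y‖ - g 0 := by fun_prop
      simpa using this.tendsto 0
    have h1 : (fun y : E => (inner ℝ y v : ℝ)) =O[nhds 0] (fun y : E => y) :=
      Asymptotics.IsBigO.of_bound ‖v‖ (Eventually.of_forall fun y => by
        rw [mul_comm]; exact norm_inner_le_norm y v)
    have h2 := h0.mul_isBigO h1.norm_right
    simp only [one_mul] at h2
    refine h2.of_norm_right.congr_left fun y => ?_
    simp [real_inner_comm v y]
    ring
  · have h1 := (hgd ‖x‖ (norm_pos_iff.2 hx)).comp_hasFDerivAt x (hasFDerivAt_norm_of_ne_zero hx)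
    refine (h1.mul (hinner x)).congr_fderiv ?_
    ext y
    have hx' : ‖x‖ ≠ 0 := norm_ne_zero_iff.2 hx
    simp [radialHessian]
    field_simp

lemma continuous_radialHessian {g m : ℝ → ℝ} (hg : Continuous g) (hm : Continuous m)
    (hm0 : m 0 = 0) (v : E) : Continuous (radialHessian g m v) := by
  have h1 : Continuous fun x : E => g ‖x‖ • innerSL ℝ v := by fun_prop
  refine h1.add (continuous_iff_continuousAt.2 fun x => ?_)
  rcases eq_or_ne x 0 with rfl | hx
  · have h2 : Tendsto (fun x : E => |m ‖x‖| * ‖v‖) (nhds 0) (nhds 0) := by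
      have : Continuous fun x : E => |m ‖x‖| * ‖v‖ := by fun_prop
      simpa [hm0] using this.tendsto 0
    unfold ContinuousAt
    simp only [inner_zero_left, mul_zero, zero_smul]
    refine squeeze_zero_norm (fun x => ?_) h2
    rw [norm_smul, norm_mul, norm_div, norm_pow, norm_norm, innerSL_apply_norm, Real.norm_eq_abs]
    rcases eq_or_ne x 0 with rfl | hx
    · simp; positivity
    · have hx' : 0 < ‖x‖ := norm_pos_iff.2 hx
      calc |m ‖x‖| / ‖x‖ ^ 2 * ‖(inner ℝ x v : ℝ)‖ * ‖x‖
          ≤ |m ‖x‖| / ‖x‖ ^ 2 * (‖x‖ * ‖v‖) * ‖x‖ := by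
            gcongr
            exact norm_inner_le_norm x v
        _ = _ := by field_simp
  · have hx' : ‖x‖ ^ 2 ≠ 0 := pow_ne_zero 2 (norm_ne_zero_iff.2 hx)
    have hc1 : ContinuousAt (fun x : E => m ‖x‖ / ‖x‖ ^ 2 * inner ℝ x v) x :=
      ContinuousAt.mul (ContinuousAt.div (by fun_prop) (by fun_prop) hx') (by fun_prop)
    exact hc1.smul (innerSL ℝ).continuous.continuousAt

/-- A radial function with gradient `g(|x|) x`, where `g'(r) = m(r) / r` and `m(0) = 0`,
is `C²`. -/
lemma contDiff_two_radial [FiniteDimensional ℝ E] {φ g m : ℝ → ℝ} (hg : Continuous g)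
    (hm : Continuous m) (hm0 : m 0 = 0)
    (hφ : ∀ r, 0 ≤ r → φ r = φ 0 + ∫ s in (0 : ℝ)..r, s * g s)
    (hgd : ∀ r, 0 < r → HasDerivAt g (m r / r) r) :
    ContDiff ℝ 2 (fun x : E => φ ‖x‖) := by
  have h1 : (2 : WithTop ℕ∞) = 1 + 1 := by norm_num
  rw [h1, contDiff_succ_iff_fderiv_apply]
  refine ⟨fun x => (hasFDerivAt_radial hg hφ x).differentiableAt, by simp, fun v => ?_⟩
  simp only [(hasFDerivAt_radial hg hφ _).fderiv]
  rw [contDiff_one_iff_hasFDerivAt]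
  exact ⟨_, continuous_radialHessian hg hm hm0 v, fun x => hasFDerivAt_radialGradient hg hgd v x⟩

end Radial

lemma lap_radial {n : ℕ} {φ g m : ℝ → ℝ} (hg : Continuous g) (hm0 : m 0 = 0)
    (hφ : ∀ r, 0 ≤ r → φ r = φ 0 + ∫ s in (0 : ℝ)..r, s * g s)
    (hgd : ∀ r, 0 < r → HasDerivAt g (m r / r) r) (x : Eucl n) :
    lap (fun y => φ ‖y‖) x = n * g ‖x‖ + m ‖x‖ := by
  have hgrad : ∀ v y : Eucl n, fderiv ℝ (fun y : Eucl n => φ ‖y‖) y v = g ‖y‖ * inner ℝ y v :=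
    fun v y => by rw [(hasFDerivAt_radial hg hφ y).fderiv]; simp
  unfold lap
  simp only [hgrad, (hasFDerivAt_radialGradient hg hgd _ x).fderiv, radialHessian]
  have hsum : ∑ i : Fin n, x i * x i = ‖x‖ ^ 2 := by
    rw [EuclideanSpace.real_norm_sq_eq]
    exact Finset.sum_congr rfl fun i _ => (sq _).symm
  have hterm : ∀ i : Fin n, (g ‖x‖ • innerSL ℝ (EuclideanSpace.single i (1 : ℝ)) +
      (m ‖x‖ / ‖x‖ ^ 2 * inner ℝ x (EuclideanSpace.single i (1 : ℝ))) • innerSL ℝ x)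
        (EuclideanSpace.single i (1 : ℝ)) = g ‖x‖ + m ‖x‖ / ‖x‖ ^ 2 * (x i * x i) := by
    intro i
    simp [EuclideanSpace.inner_single_right]
    ring
  rw [Finset.sum_congr rfl fun i _ => hterm i, Finset.sum_add_distrib, ← Finset.mul_sum, hsum]
  rcases eq_or_ne x 0 with rfl | hx
  · simp [hm0]
  · have hx' : ‖x‖ ≠ 0 := norm_ne_zero_iff.2 hx
    simp [div_mul_cancel₀ _ (pow_ne_zero 2 hx')]

/-- Bound on the derivative of the corrected logarithm of `φ' + lφ`, where `A = φ / (φ' + lφ)` and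
`B = φ' / (φ' + lφ)`. -/
lemma abs_logDeriv_error_le {l d N b A B w r : ℝ} (hl : 0 < l) (hN : 0 ≤ N) (hr : 1 ≤ r)
    (hA : 0 ≤ A) (hB : 0 ≤ B) (hAB : l * A + B = 1) :
    |w * A - b * (A / r ^ 2 + A * (l * d * A - N * B) / r ^ 2 + w * A ^ 2 / r)| ≤
      (1 / l + |b| / l ^ 2) * |w| + |b| * (1 + |d| + N) / l * (r ^ 2)⁻¹ := by
  have hr0 : 0 < r := one_pos.trans_le hr
  have hA1 : A ≤ 1 / l := by rw [le_div_iff₀ hl]; linarith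
  have h1 : |w * A| ≤ 1 / l * |w| := by
    rw [abs_mul, abs_of_nonneg hA, mul_comm]
    gcongr
  have h2 : |A / r ^ 2| ≤ 1 / l * (r ^ 2)⁻¹ := by
    rw [abs_of_nonneg (by positivity), div_eq_mul_inv]
    gcongr
  have h3 : |A * (l * d * A - N * B) / r ^ 2| ≤ 1 / l * (|d| + N) * (r ^ 2)⁻¹ := by
    rw [abs_div, abs_mul, abs_of_nonneg hA, abs_of_pos (pow_pos hr0 2), div_eq_mul_inv]
    have h4 : |l * d * A - N * B| ≤ |d| + N := by
      have h5 : |l * d * A| ≤ |d| := by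
        rw [show l * d * A = d * (l * A) by ring, abs_mul, abs_of_nonneg (by positivity : 0 ≤ l * A)]
        exact mul_le_of_le_one_right (abs_nonneg d) (by linarith)
      have h6 : |N * B| ≤ N := by
        rw [abs_of_nonneg (by positivity)]
        exact mul_le_of_le_one_right hN (by nlinarith [mul_nonneg hl.le hA])
      exact (abs_sub _ _).trans (add_le_add h5 h6)
    gcongr
  have h7 : |w * A ^ 2 / r| ≤ 1 / l ^ 2 * |w| := by
    rw [abs_div, abs_mul, abs_of_nonneg (sq_nonneg A), abs_of_pos hr0]
    refine (div_le_self (by positivity) hr).trans ?_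
    rw [mul_comm, ← one_div_pow]
    gcongr
  have h8 : |A / r ^ 2 + A * (l * d * A - N * B) / r ^ 2 + w * A ^ 2 / r| ≤
      1 / l * (r ^ 2)⁻¹ + 1 / l * (|d| + N) * (r ^ 2)⁻¹ + 1 / l ^ 2 * |w| :=
    (abs_add_three _ _ _).trans (add_le_add (add_le_add h2 h3) h7)
  refine (abs_sub _ _).trans ((add_le_add h1 ((abs_mul _ _).trans_le
    (mul_le_mul_of_nonneg_left h8 (abs_nonneg b)))).trans_eq ?_)
  field_simp
  ring

/-- A function whose derivative is dominated by an integrable function is bounded. -/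
lemma abs_sub_le_of_integrable_deriv_bound {F F' h : ℝ → ℝ} {R : ℝ}
    (hF : ∀ r, R ≤ r → HasDerivAt F (F' r) r) (hFh : ∀ r, R ≤ r → |F' r| ≤ h r)
    (hh : IntegrableOn h (Ici R)) {r : ℝ} (hr : R ≤ r) :
    |F r - F R| ≤ ∫ s in Ici R, h s := by
  have hi : IntegrableOn h (Icc R r) := hh.mono_set Icc_subset_Ici_self
  have hle : ∫ s in R..r, h s ≤ ∫ s in Ici R, h s := by
    rw [intervalIntegral.integral_of_le hr]
    refine setIntegral_mono_set hh ?_ (Eventually.of_forall fun s hs => hs.1.le)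
    exact (ae_restrict_iff' measurableSet_Ici).2
      (Eventually.of_forall fun s hs => (abs_nonneg _).trans (hFh s hs))
  have h1 := intervalIntegral.sub_le_integral_of_hasDeriv_right_of_le hr
    (fun s hs => (hF s hs.1).continuousAt.continuousWithinAt)
    (fun s hs => (hF s hs.1.le).hasDerivWithinAt) hi
    (fun s hs => (le_abs_self _).trans (hFh s hs.1.le))
  have h2 := intervalIntegral.sub_le_integral_of_hasDeriv_right_of_le hr
    (g := fun s => -F s) (g' := fun s => -F' s)
    (fun s hs => (hF s hs.1).neg.continuousAt.continuousWithinAt)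
    (fun s hs => (hF s hs.1.le).neg.hasDerivWithinAt) hi
    (fun s hs => (neg_le_abs _).trans (hFh s hs.1.le))
  rw [abs_le]
  constructor <;> linarith

/-- For a positive nondecreasing solution of `φ'' + (N/r) φ' = (l² + l d / r + w) φ` with `w`
integrable, `φ' + lφ` is comparable to `r^((d - N)/2) e^(lr)`. -/
lemma exists_bound_log_deriv_add {φ y w : ℝ → ℝ} {l d N R : ℝ} (hl : 0 < l) (hN : 0 ≤ N)
    (hR : 1 ≤ R) (hφ : ∀ r, R ≤ r → HasDerivAt φ (y r) r)
    (hy : ∀ r, R ≤ r → HasDerivAt y ((l ^ 2 + l * d / r + w r) * φ r - N / r * y r) r)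
    (hφ0 : ∀ r, R ≤ r → 0 < φ r) (hy0 : ∀ r, R ≤ r → 0 ≤ y r) (hw : IntegrableOn w (Ici R)) :
    ∃ M, ∀ r, R ≤ r →
      |Real.log (y r + l * φ r) - l * r - (d - N) / 2 * Real.log r| ≤ M := by
  set b : ℝ := (d + N) / 2 with hb
  let F : ℝ → ℝ := fun r => Real.log (y r + l * φ r) - l * r - (d - N) / 2 * Real.log r +
    b * (φ r / (r * (y r + l * φ r)))
  let A : ℝ → ℝ := fun r => φ r / (y r + l * φ r)
  let B : ℝ → ℝ := fun r => y r / (y r + l * φ r)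
  have hψ : ∀ r, R ≤ r → 0 < y r + l * φ r := fun r hr =>
    add_pos_of_nonneg_of_pos (hy0 r hr) (mul_pos hl (hφ0 r hr))
  have hAB : ∀ r, R ≤ r → l * A r + B r = 1 := fun r hr => by
    have := (hψ r hr).ne'
    simp only [A, B]
    field_simp
    ring
  have hA : ∀ r, R ≤ r → 0 ≤ A r := fun r hr => div_nonneg (hφ0 r hr).le (hψ r hr).le
  have hB : ∀ r, R ≤ r → 0 ≤ B r := fun r hr => div_nonneg (hy0 r hr) (hψ r hr).le
  have hF : ∀ r, R ≤ r → HasDerivAt F (w r * A r - b * (A r / r ^ 2 +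
      A r * (l * d * A r - N * B r) / r ^ 2 + w r * A r ^ 2 / r)) r := by
    intro r hr
    have hr0 : 0 < r := one_pos.trans_le (hR.trans hr)
    have hψr := hψ r hr
    have hψd := (hy r hr).add ((hφ r hr).const_mul l)
    have h1 := (hψd.log hψr.ne').sub ((hasDerivAt_id r).const_mul l)
    have h2 := h1.sub ((Real.hasDerivAt_log hr0.ne').const_mul ((d - N) / 2))
    have h3 := ((hφ r hr).div ((hasDerivAt_id r).mul hψd)
      (mul_pos hr0 hψr).ne').const_mul b
    refine (h2.add h3).congr_deriv ?_
    simp only [A, B, hb, id, Pi.add_apply, Pi.mul_apply]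
    obtain ⟨p, hp⟩ : ∃ p, p = y r + l * φ r := ⟨_, rfl⟩
    have hyp : y r = p - l * φ r := by rw [hp]; ring
    rw [← hp] at hψr ⊢
    rw [hyp]
    have := hr0.ne'
    have := hψr.ne'
    field_simp
    ring
  have hint : IntegrableOn (fun r => (1 / l + |b| / l ^ 2) * |w r| +
      |b| * (1 + |d| + N) / l * (r ^ 2)⁻¹) (Ici R) := by
    refine (hw.abs.const_mul _).add (Integrable.const_mul ?_ _)
    have h := (integrableOn_Ici_iff_integrableOn_Ioi).2
      (integrableOn_Ioi_rpow_of_lt (by norm_num : (-2 : ℝ) < -1) (one_pos.trans_le hR))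
    refine IntegrableOn.congr_fun h (fun r hr => ?_) measurableSet_Ici
    have hr0 : 0 < r := one_pos.trans_le (hR.trans hr)
    rw [Real.rpow_neg hr0.le, Real.rpow_two]
  have hbd : ∀ r, R ≤ r → |F r - F R| ≤ _ := fun r hr =>
    abs_sub_le_of_integrable_deriv_bound hF (fun s hs => abs_logDeriv_error_le (d := d) (b := b)
      (w := w s) hl hN (hR.trans hs) (hA s hs) (hB s hs) (hAB s hs)) hint hr
  refine ⟨(∫ s in Ici R, ((1 / l + |b| / l ^ 2) * |w s| +
    |b| * (1 + |d| + N) / l * (s ^ 2)⁻¹)) + |F R| + |b| / l, fun r hr => ?_⟩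
  have hr1 : 1 ≤ r := hR.trans hr
  have hT : |b * (φ r / (r * (y r + l * φ r)))| ≤ |b| / l := by
    rw [abs_mul, div_eq_mul_one_div |b|, mul_comm r, ← div_div]
    have hA0 := hA r hr
    have hA1 : A r ≤ 1 / l := by
      rw [le_div_iff₀ hl]
      linarith [hAB r hr, hB r hr]
    gcongr
    rw [abs_of_nonneg (div_nonneg hA0 (by positivity))]
    exact (div_le_self hA0 hr1).trans hA1
  have heq : Real.log (y r + l * φ r) - l * r - (d - N) / 2 * Real.log r =
      (F r - F R) + F R - b * (φ r / (r * (y r + l * φ r))) := by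
    simp only [F]; ring
  rw [heq]
  refine (abs_sub _ _).trans (add_le_add ((abs_add_le _ _).trans ?_) hT)
  gcongr
  exact hbd r hr

lemma abs_log_sub_log_le {ξ r : ℝ} (hξ : 1 ≤ ξ) (h1 : r - 1 ≤ ξ) (h2 : ξ ≤ r) :
    |Real.log ξ - Real.log r| ≤ Real.log 2 := by
  have hξ0 : 0 < ξ := one_pos.trans_le hξ
  have hr0 : 0 < r := hξ0.trans_le h2
  have h3 : Real.log ξ ≤ Real.log r := Real.log_le_log hξ0 h2
  have h4 : Real.log r ≤ Real.log (2 * ξ) := Real.log_le_log hr0 (by linarith)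
  rw [Real.log_mul two_ne_zero hξ0.ne'] at h4
  rw [abs_le]
  constructor <;> linarith [Real.log_nonneg one_le_two]

lemma abs_log_sqrt_sub_log_le {r : ℝ} (hr : 1 ≤ r) :
    |Real.log (√(1 + r ^ 2)) - Real.log r| ≤ Real.log 2 := by
  have hr0 : 0 < r := one_pos.trans_le hr
  have h1 : Real.log r ≤ Real.log (√(1 + r ^ 2)) :=
    Real.log_le_log hr0 (Real.le_sqrt_of_sq_le (by linarith))
  have h2 : Real.log (√(1 + r ^ 2)) ≤ Real.log (2 * r) :=
    Real.log_le_log (Real.sqrt_pos.2 (by positivity))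
      (Real.sqrt_le_iff.2 ⟨by positivity, by nlinarith⟩)
  rw [Real.log_mul two_ne_zero hr0.ne'] at h2
  rw [abs_le]
  constructor <;> linarith [Real.log_nonneg one_le_two]

/-- If `φ' + lφ` is comparable to `r^a e^(lr)` near infinity, then so is `φ`. -/
lemma abs_log_le_of_abs_log_deriv_add_le {φ y : ℝ → ℝ} {l a R M : ℝ} (hl : 0 < l) (hR : 1 ≤ R)
    (hφ : ∀ r, R ≤ r → HasDerivAt φ (y r) r) (hφ0 : ∀ r, R ≤ r → 0 < φ r)
    (hy0 : ∀ r, R ≤ r → 0 ≤ y r)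
    (hM : ∀ r, R ≤ r → |Real.log (y r + l * φ r) - l * r - a * Real.log r| ≤ M)
    {r : ℝ} (hr : R + 1 ≤ r) :
    |Real.log (φ r) - l * r - a * Real.log r| ≤ M + |Real.log l| + 2 * l + |a| * Real.log 2 := by
  have hψ : ∀ r, R ≤ r → 0 < y r + l * φ r := fun r hr =>
    add_pos_of_nonneg_of_pos (hy0 r hr) (mul_pos hl (hφ0 r hr))
  have ha : 0 ≤ |a| * Real.log 2 := mul_nonneg (abs_nonneg a) (Real.log_nonneg one_le_two)
  have hrR : R ≤ r := by linarith
  have hup : Real.log l + Real.log (φ r) ≤ Real.log (y r + l * φ r) := by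
    rw [← Real.log_mul hl.ne' (hφ0 r hrR).ne']
    exact Real.log_le_log (mul_pos hl (hφ0 r hrR)) (by linarith [hy0 r hrR])
  have hd : ∀ s, R ≤ s → HasDerivAt (fun s => Real.exp (l * s) * φ s)
      (Real.exp (l * s) * (y s + l * φ s)) s := fun s hs => by
    refine ((((hasDerivAt_id s).const_mul l).exp).mul (hφ s hs)).congr_deriv ?_
    simp only [id]
    ring
  obtain ⟨ξ, hξ, hξe⟩ := exists_hasDerivAt_eq_slope (fun s => Real.exp (l * s) * φ s) _
    (sub_one_lt r) (fun s hs => (hd s (by linarith [hs.1])).continuousAt.continuousWithinAt)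
    (fun s hs => hd s (by linarith [hs.1]))
  have hξR : R ≤ ξ := by linarith [hξ.1]
  have hle : Real.exp (l * ξ) * (y ξ + l * φ ξ) ≤ Real.exp (l * r) * φ r := by
    rw [hξe, sub_sub_cancel, div_one]
    linarith [mul_pos (Real.exp_pos (l * (r - 1))) (hφ0 (r - 1) (by linarith))]
  have hlog := Real.log_le_log (mul_pos (Real.exp_pos _) (hψ ξ hξR)) hle
  rw [Real.log_mul (Real.exp_pos _).ne' (hψ ξ hξR).ne', Real.log_exp,
    Real.log_mul (Real.exp_pos _).ne' (hφ0 r hrR).ne', Real.log_exp] at hlog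
  have h1 := abs_le.1 (hM r hrR)
  have h2 := abs_le.1 (hM ξ hξR)
  have h3 : |a * (Real.log ξ - Real.log r)| ≤ |a| * Real.log 2 := by
    rw [abs_mul]
    exact mul_le_mul_of_nonneg_left
      (abs_log_sub_log_le (hR.trans hξR) hξ.1.le hξ.2.le) (abs_nonneg a)
  have h4 := abs_le.1 h3
  have h5 : l * (r - 1) ≤ l * ξ := mul_le_mul_of_nonneg_left hξ.1.le hl.le
  have h6 := neg_abs_le (Real.log l)
  have h7 := abs_nonneg (Real.log l)
  rw [abs_le]
  constructor <;> nlinarith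

lemma exists_two_sided_bound {φ y : ℝ → ℝ} {l a R M : ℝ} (hl : 0 < l) (hR : 1 ≤ R)
    (hc : Continuous φ) (hφ0 : ∀ r, 0 < φ r)
    (hφ : ∀ r, R ≤ r → HasDerivAt φ (y r) r) (hy0 : ∀ r, R ≤ r → 0 ≤ y r)
    (hM : ∀ r, R ≤ r → |Real.log (y r + l * φ r) - l * r - a * Real.log r| ≤ M) :
    ∃ c C : ℝ, 0 < c ∧ c < C ∧ ∀ r, 0 ≤ r →
      c * √(1 + r ^ 2) ^ a * Real.exp (l * r) ≤ φ r ∧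
      φ r ≤ C * √(1 + r ^ 2) ^ a * Real.exp (l * r) := by
  have hpos : ∀ r : ℝ, 0 < √(1 + r ^ 2) := fun r => Real.sqrt_pos.2 (by positivity)
  let H : ℝ → ℝ := fun r => Real.log (φ r) - l * r - a * Real.log (√(1 + r ^ 2))
  have hH : Continuous H :=
    ((hc.log fun r => (hφ0 r).ne').sub (by fun_prop)).sub
      (continuous_const.mul (Continuous.log (by fun_prop) fun r => (hpos r).ne'))
  obtain ⟨M₁, hM₁⟩ := (isCompact_Icc (a := (0 : ℝ)) (b := R + 1)).exists_bound_of_continuousOn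
    hH.continuousOn
  obtain ⟨M₂, hM₂⟩ : ∃ M₂, ∀ r, R + 1 ≤ r → |H r| ≤ M₂ := by
    refine ⟨M + |Real.log l| + 2 * l + |a| * Real.log 2 + |a| * Real.log 2, fun r hr => ?_⟩
    have h1 := abs_log_le_of_abs_log_deriv_add_le hl hR hφ (fun r _ => hφ0 r) hy0 hM hr
    have h2 : |a * (Real.log (√(1 + r ^ 2)) - Real.log r)| ≤ |a| * Real.log 2 := by
      rw [abs_mul]
      exact mul_le_mul_of_nonneg_left (abs_log_sqrt_sub_log_le (by linarith)) (abs_nonneg a)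
    have h3 : H r = (Real.log (φ r) - l * r - a * Real.log r) -
        a * (Real.log (√(1 + r ^ 2)) - Real.log r) := by
      simp only [H]; ring
    rw [h3]
    exact (abs_sub _ _).trans (add_le_add h1 h2)
  obtain ⟨K, hK0, hK⟩ : ∃ K, 0 < K ∧ ∀ r, 0 ≤ r → |H r| ≤ K := by
    refine ⟨max (max M₁ M₂) 1, by positivity, fun r hr => ?_⟩
    rcases le_total r (R + 1) with h | h
    · exact (hM₁ r ⟨hr, h⟩).trans ((le_max_left _ _).trans (le_max_left _ _))
    · exact (hM₂ r h).trans ((le_max_right _ _).trans (le_max_left _ _))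
  refine ⟨Real.exp (-K), Real.exp K, Real.exp_pos _, Real.exp_lt_exp.2 (by linarith),
    fun r hr => ?_⟩
  have h := abs_le.1 (hK r hr)
  have hφe : φ r = Real.exp (H r) * √(1 + r ^ 2) ^ a * Real.exp (l * r) := by
    rw [Real.rpow_def_of_pos (hpos r), ← Real.exp_add, ← Real.exp_add,
      show H r + Real.log (√(1 + r ^ 2)) * a + l * r = Real.log (φ r) by simp only [H]; ring,
      Real.exp_log (hφ0 r)]
  have hp : 0 ≤ √(1 + r ^ 2) ^ a := Real.rpow_nonneg (hpos r).le a
  rw [hφe]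
  constructor
  · gcongr
    exact h.1
  · gcongr
    exact h.2

/-- Lemma 2.4: existence of a `C²` "eigenfunction" of `Δφ = (λ₀² + λ₀D + V)φ` with
`φ ≃ ⟨r⟩^{-(n-1-d_∞)/2} e^{λ₀ r}` globally. -/
theorem exists_C2_eigenfunction_VD_laplacian
    (n : ℕ) (hn : 2 ≤ n) (lam0 : ℝ) (hlam0 : 0 < lam0)
    (V D : Eucl n → ℝ) (Vr Dr : ℝ → ℝ)
    (hVrad : ∀ x, V x = Vr ‖x‖) (hDrad : ∀ x, D x = Dr ‖x‖)
    (hVc : Continuous V) (hDc : Continuous D)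
    (hVholder : ∃ (δ Ch : ℝ≥0), 0 < δ ∧ HolderOnWith Ch δ V (Metric.ball 0 δ))
    (hDholder : ∃ (δ Ch : ℝ≥0), 0 < δ ∧ HolderOnWith Ch δ D (Metric.ball 0 δ))
    (hVnonneg : ∀ x, 0 ≤ V x)
    (hDlow : ∀ x, -lam0 - V x / lam0 ≤ D x)
    (d_inf R : ℝ) (hR : 1 < R) (Dinf : ℝ → ℝ)
    (hVint : IntegrableOn Vr (Ici R))
    (hDinf : ∀ r : ℝ, R ≤ r → Dr r = d_inf / r + Dinf r)
    (hDinfint : IntegrableOn Dinf (Ici R)) :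
    ∃ (φ : Eucl n → ℝ) (c C : ℝ), 0 < c ∧ c < C ∧
      ContDiff ℝ 2 φ ∧
      (∀ x, lap φ x = (lam0 ^ 2 + lam0 * D x + V x) * φ x) ∧
      (∀ x : Eucl n,
        c * Real.sqrt (1 + ‖x‖ ^ 2) ^ (-(((n : ℝ) - 1 - d_inf) / 2)) *
            Real.exp (lam0 * ‖x‖) ≤ φ x ∧
        φ x ≤ C * Real.sqrt (1 + ‖x‖ ^ 2) ^ (-(((n : ℝ) - 1 - d_inf) / 2)) *
            Real.exp (lam0 * ‖x‖)) := by
  let e : Eucl n := EuclideanSpace.single ⟨0, by omega⟩ 1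
  let q : ℝ → ℝ := fun r => lam0 ^ 2 + lam0 * D (r • e) + V (r • e)
  have hnorm : ∀ r : ℝ, 0 ≤ r → ‖r • e‖ = r := fun r hr => by
    simp [e, norm_smul, abs_of_nonneg hr]
  have hqc : Continuous q := by fun_prop
  have hq0 : ∀ r, 0 ≤ q r := fun r => by
    have h := mul_le_mul_of_nonneg_left (hDlow (r • e)) hlam0.le
    have h' : lam0 * (-lam0 - V (r • e) / lam0) = -lam0 ^ 2 - V (r • e) := by
      field_simp
    simp only [q]
    linarith
  have hqx : ∀ x : Eucl n, q ‖x‖ = lam0 ^ 2 + lam0 * D x + V x := fun x => by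
    simp only [q, hVrad, hDrad, hnorm _ (norm_nonneg x)]
  have hn1 : 1 ≤ n := by omega
  obtain ⟨f, hfc, hf1, hfix⟩ := exists_radialVolterra_fixedPoint n hqc hq0
  have hf0 : ∀ r, 0 < f r := fun r => one_pos.trans_le (hf1 r)
  let g : ℝ → ℝ := radialAverage n q f
  let m : ℝ → ℝ := fun r => q r * f r - n * g r
  have hgc : Continuous g := continuous_radialAverage n hqc hfc
  have hmc : Continuous m := by fun_prop
  have hm0 : m 0 = 0 := sub_eq_zero.2 (mul_radialAverage_zero hn1 q f).symm
  have hfint : ∀ r, 0 ≤ r → f r = f 0 + ∫ s in (0 : ℝ)..r, s * g s := fun r hr => by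
    rw [hfix r, hfix 0]
    simp [radialVolterra, abs_of_nonneg hr, g]
  have hgd : ∀ r, 0 < r → HasDerivAt g (m r / r) r := fun r hr =>
    hasDerivAt_radialAverage hn1 hqc hfc hr
  have hfd : ∀ r, R ≤ r → HasDerivAt f (r * g r) r := fun r hr =>
    hasDerivAt_of_radialVolterra_fixedPoint hqc hfc hfix (by linarith)
  have hyd : ∀ r, R ≤ r → HasDerivAt (fun r => r * g r)
      ((lam0 ^ 2 + lam0 * d_inf / r + (lam0 * Dinf r + Vr r)) * f r -
        ((n : ℝ) - 1) / r * (r * g r)) r := fun r hr => by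
    have hr0 : 0 < r := by linarith
    refine ((hasDerivAt_id r).mul (hgd r hr0)).congr_deriv ?_
    have hqr : q r = lam0 ^ 2 + lam0 * (d_inf / r + Dinf r) + Vr r := by
      simp only [q, hVrad, hDrad, hnorm r hr0.le, hDinf r hr]
    simp only [m, hqr, id]
    field_simp
    ring
  have hN : (0 : ℝ) ≤ (n : ℝ) - 1 := sub_nonneg.2 (by exact_mod_cast hn1)
  have hy0 : ∀ r, R ≤ r → 0 ≤ r * g r := fun r hr =>
    mul_nonneg (by linarith) (radialAverage_nonneg n hq0 (fun s => (hf0 s).le) r)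
  obtain ⟨M, hM⟩ := exists_bound_log_deriv_add hlam0 hN hR.le hfd hyd (fun r _ => hf0 r) hy0
    ((hDinfint.const_mul lam0).add hVint)
  obtain ⟨c, C, hc, hcC, hbd⟩ := exists_two_sided_bound hlam0 hR.le hfc hf0 hfd hy0 hM
  refine ⟨fun x => f ‖x‖, c, C, hc, hcC, contDiff_two_radial hgc hmc hm0 hfint hgd,
    fun x => ?_, fun x => ?_⟩
  · rw [lap_radial hgc hm0 hfint hgd, ← hqx]
    simp only [m]
    ring
  · rw [show -(((n : ℝ) - 1 - d_inf) / 2) = (d_inf - ((n : ℝ) - 1)) / 2 by ring]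
    exact hbd ‖x‖ (norm_nonneg x)
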